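/- Let p ≥ 2 be an integer and α ∈ (1,2). There exists a constant c_{p,α}^L > 0 depending only on p and α such that for all n ≥ 1 and all i, j ∈ {2, …, n+p-1}, the entries of the matrix A_n^L satisfy: |(A_n^L)_{i-1,j-1}| = 0 if η_i ≤ ξ_j; |(A_n^L)_{i-1,j-1}| ≤ c_{p,α}^L · n^α if ξ_j < η_i ≤ ξ_{j+p+1} + 1/n; and |(A_n^L)_{i-1,j-1}| ≤ c_{p,α}^L · (η_i - ξ_{j+p+1})^{-α} if ξ_{j+p+1} + 1/n < η_i. -/

import Mathlib

open MeasureTheory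

/-- Open uniform knot sequence on [0,1]. -/
noncomputable def knot (p n : ℕ) (i : ℕ) : ℝ :=
  if i ≤ p + 1 then 0 else if n + p + 1 ≤ i then 1 else ((i : ℝ) - ((p : ℝ) + 1)) / n

/-- B-splines of degree `k` (Cox–de Boor recurrence) on the above knots. -/
noncomputable def bspline (p n : ℕ) : ℕ → ℕ → ℝ → ℝ
  | 0, i, x => if knot p n i ≤ x ∧ x < knot p n (i + 1) then 1 else 0
  | (k + 1), i, x =>
      (if knot p n (i + k + 1) = knot p n i then 0
        else (x - knot p n i) / (knot p n (i + k + 1) - knot p n i) * bspline p n k i x)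
      + (if knot p n (i + k + 2) = knot p n (i + 1) then 0
        else (knot p n (i + k + 2) - x) / (knot p n (i + k + 2) - knot p n (i + 1))
              * bspline p n k (i + 1) x)

/-- Greville abscissae. -/
noncomputable def greville (p n : ℕ) (i : ℕ) : ℝ :=
  (∑ j ∈ Finset.range p, knot p n (i + 1 + j)) / p

/-- Left Riemann–Liouville fractional derivative on `[0,1]`, `α ∈ (1,2)`. -/
noncomputable def RLD0x (α : ℝ) (u : ℝ → ℝ) (x : ℝ) : ℝ :=
  (1 / Real.Gamma (2 - α)) *
    deriv (deriv (fun z => ∫ y in (0:ℝ)..z, (z - y) ^ (1 - α) * u y)) x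

open Set

set_option linter.all false

lemma knot_eq (p n i : ℕ) (hn : 1 ≤ n) : knot p n i = ((min n (i - (p+1)) : ℕ) : ℝ) / n := by
  have hn' : (n:ℝ) ≠ 0 := by positivity
  unfold knot
  split_ifs with h h'
  · have : i - (p+1) = 0 := by omega
    simp [this]
  · have : min n (i - (p+1)) = n := by omega
    rw [this, div_self hn']
  · have : min n (i - (p+1)) = i - (p+1) := by omega
    rw [this, Nat.cast_sub (by omega)]
    push_cast; rfl

lemma knot_mono (p n : ℕ) (hn : 1 ≤ n) {i j : ℕ} (h : i ≤ j) : knot p n i ≤ knot p n j := by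
  rw [knot_eq p n i hn, knot_eq p n j hn]
  gcongr

lemma knot_nonneg (p n i : ℕ) (hn : 1 ≤ n) : 0 ≤ knot p n i := by
  rw [knot_eq p n i hn]; positivity

lemma knot_le_one (p n i : ℕ) (hn : 1 ≤ n) : knot p n i ≤ 1 := by
  rw [knot_eq p n i hn]
  have hn' : (0:ℝ) < n := by positivity
  rw [div_le_one hn']
  exact_mod_cast min_le_left _ _

lemma knot_gap (p n : ℕ) (hn : 1 ≤ n) {i j : ℕ} (h : knot p n i < knot p n j) :
    1 / (n:ℝ) ≤ knot p n j - knot p n i := by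
  have hn' : (0:ℝ) < n := by positivity
  rw [knot_eq p n i hn, knot_eq p n j hn] at *
  rw [← sub_div]
  rw [div_lt_div_iff_of_pos_right hn'] at h
  have h' : min n (i - (p+1)) + 1 ≤ min n (j - (p+1)) := by exact_mod_cast h
  have : ((min n (i - (p+1)) : ℕ) : ℝ) + 1 ≤ ((min n (j - (p+1)) : ℕ) : ℝ) := by exact_mod_cast h'
  gcongr
  linarith

lemma knot_inv (p n : ℕ) (hn : 1 ≤ n) {i j : ℕ} (h : i ≤ j) :
    |(knot p n j - knot p n i)⁻¹ / n| ≤ 1 := by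
  have hn' : (0:ℝ) < n := by positivity
  rcases (knot_mono p n hn h).lt_or_eq with h | h
  · have := knot_gap p n hn h
    have h0 : 0 < knot p n j - knot p n i := by linarith
    rw [abs_of_nonneg (by positivity), div_le_one hn']
    rw [div_le_iff₀ hn'] at this
    rw [inv_le_iff_one_le_mul₀ h0]; linarith
  · simp [h]

lemma knot_width (p n i m : ℕ) (hn : 1 ≤ n) : knot p n (i+m) ≤ knot p n i + m / n := by
  have hn' : (0:ℝ) < n := by positivity
  rw [knot_eq p n i hn, knot_eq p n _ hn, ← add_div]
  gcongr
  have : min n (i + m - (p+1)) ≤ min n (i - (p+1)) + m := by omega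
  exact_mod_cast this

lemma knot_double (p n i : ℕ) (hn : 1 ≤ n) (h : knot p n i = knot p n (i+1)) :
    knot p n i = 0 ∨ knot p n i = 1 := by
  have hn' : (n:ℝ) ≠ 0 := by positivity
  rw [knot_eq p n i hn, knot_eq p n _ hn] at *
  rw [div_left_inj' hn'] at h
  have h : min n (i - (p+1)) = min n (i + 1 - (p+1)) := by exact_mod_cast h
  by_cases hi : i ≤ p+1
  · left; have : i - (p+1) = 0 := by omega
    simp [this]
  · right; have : min n (i - (p+1)) = n := by omega
    rw [this, div_self hn']

lemma bs_succ (p n k i : ℕ) (x : ℝ) : bspline p n (k+1) i x =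
    (x - knot p n i) * (knot p n (i+k+1) - knot p n i)⁻¹ * bspline p n k i x
    + (knot p n (i+k+2) - x) * (knot p n (i+k+2) - knot p n (i+1))⁻¹ * bspline p n k (i+1) x := by
  rw [bspline]
  congr 1
  · split_ifs with h
    · simp [h]
    · rw [div_eq_mul_inv]
  · split_ifs with h
    · simp [h]
    · rw [div_eq_mul_inv]

lemma bs_supp (p n : ℕ) (hn : 1 ≤ n) (k : ℕ) : ∀ (i : ℕ) (x : ℝ),
    (x < knot p n i ∨ knot p n (i+k+1) ≤ x) → bspline p n k i x = 0 := by
  induction k with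
  | zero =>
    intro i x h
    rw [bspline, if_neg]
    rintro ⟨h1, h2⟩
    simp at h
    rcases h with h | h <;> linarith
  | succ k ih =>
    intro i x h
    rw [bs_succ, ih i x, ih (i+1) x]
    · simp
    · rcases h with h | h
      · left; exact h.trans_le (knot_mono p n hn (by omega))
      · right; convert h using 2; ring
    · rcases h with h | h
      · left; exact h
      · right; exact (knot_mono p n hn (by omega)).trans h

lemma bs_bound (p n : ℕ) (hn : 1 ≤ n) (k : ℕ) : ∀ (i : ℕ) (x : ℝ),
    |bspline p n k i x| ≤ 2^k := by
  induction k with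
  | zero => intro i x; rw [bspline]; split_ifs <;> simp
  | succ k ih =>
    intro i x
    by_cases hx : x < knot p n i ∨ knot p n (i+(k+1)+1) ≤ x
    · rw [bs_supp p n hn _ _ _ hx]; simp
    push Not at hx
    have e : ∀ a b c : ℝ, |a * b| ≤ 1 → |c| ≤ 2^k → |a * b * c| ≤ 2^k := by
      intro a b c h1 h2
      rw [abs_mul]
      calc _ ≤ 1 * (2:ℝ)^k := by gcongr
        _ = _ := one_mul _
    have f : ∀ a b : ℝ, 0 ≤ a → a ≤ b → |a * b⁻¹| ≤ 1 := by
      intro a b h1 h2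
      rw [← div_eq_mul_inv, abs_of_nonneg (div_nonneg h1 (h1.trans h2))]
      exact div_le_one_of_le₀ h2 (h1.trans h2)
    rw [bs_succ, pow_succ, mul_two]
    refine (abs_add_le _ _).trans (add_le_add ?_ ?_)
    · by_cases hx1 : knot p n (i+k+1) ≤ x
      · rw [bs_supp p n hn k i x (Or.inr hx1)]; simp
      · exact e _ _ _ (f _ _ (by linarith) (by linarith)) (ih _ _)
    · by_cases hx1 : x < knot p n (i+1)
      · rw [bs_supp p n hn k _ x (Or.inl hx1)]; simp
      · refine e _ _ _ (f _ _ ?_ (by linarith)) (ih _ _)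
        have := hx.2; rw [show i+(k+1)+1 = i+k+2 by ring] at this; linarith

lemma bs_meas (p n : ℕ) (k : ℕ) : ∀ (i : ℕ), Measurable (bspline p n k i) := by
  induction k with
  | zero =>
    intro i
    have : bspline p n 0 i = (Ico (knot p n i) (knot p n (i+1))).indicator (fun _ => 1) := by
      ext x; rw [bspline]; simp [indicator]
    rw [this]
    exact measurable_const.indicator measurableSet_Ico
  | succ k ih =>
    intro i
    have : bspline p n (k+1) i = fun x => _ := funext fun x => bs_succ p n k i x
    rw [this]
    have h1 := ih i
    have h2 := ih (i+1)
    fun_prop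

lemma bs_int (p n : ℕ) (hn : 1 ≤ n) (k i : ℕ) (a b : ℝ) :
    IntervalIntegrable (bspline p n k i) volume a b := by
  refine (intervalIntegrable_const (c := (2:ℝ)^k)).mono_fun
    (bs_meas p n k i).aestronglyMeasurable ?_
  filter_upwards with x
  simpa using bs_bound p n hn k i x

lemma bs_zero (p n : ℕ) (hn : 1 ≤ n) (k : ℕ) : ∀ i, i + k ≠ p + 1 → bspline p n k i 0 = 0 := by
  induction k with
  | zero =>
    intro i hi
    rw [bspline, if_neg]
    rintro ⟨h1, h2⟩
    have hn' : (0:ℝ) < n := by positivity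
    rw [knot_eq p n _ hn] at h1 h2
    have h2' : (0:ℝ) < ((min n (i + 1 - (p+1)) : ℕ) : ℝ) := by
      by_contra h; push Not at h
      have := div_nonpos_of_nonpos_of_nonneg h hn'.le
      linarith
    have h1' : ((min n (i - (p+1)) : ℕ) : ℝ) ≤ 0 := by
      by_contra h; push Not at h
      have := div_pos h hn'
      linarith
    have h1' : min n (i - (p+1)) ≤ 0 := by exact_mod_cast h1'
    have h2' : 0 < min n (i + 1 - (p+1)) := by exact_mod_cast h2'
    omega
  | succ k ih =>
    intro i hi
    rw [bs_succ, ih (i+1) (by omega)]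
    rcases (knot_nonneg p n i hn).lt_or_eq with h | h
    · rw [bs_supp p n hn k i 0 (Or.inl h)]; simp
    · simp [← h]

noncomputable def bsD (p n k i : ℕ) (x : ℝ) : ℝ :=
  (k:ℝ) * ((knot p n (i+k) - knot p n i)⁻¹ * bspline p n (k-1) i x
    - (knot p n (i+k+1) - knot p n (i+1))⁻¹ * bspline p n (k-1) (i+1) x)

lemma bs_deriv (p n : ℕ) (hn : 1 ≤ n) (k : ℕ) : ∀ (i : ℕ) (x : ℝ),
    HasDerivWithinAt (bspline p n k i) (bsD p n k i x) (Ioi x) x := by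
  induction k with
  | zero =>
    intro i x
    have : bsD p n 0 i x = 0 := by simp [bsD]
    rw [this]
    refine (hasDerivWithinAt_const x (Ioi x) (bspline p n 0 i x)).congr_of_eventuallyEq ?_ rfl
    have key : ∀ a : ℝ, ∀ᶠ y in nhdsWithin x (Ioi x), (a ≤ y ↔ a ≤ x) := by
      intro a
      by_cases h : a ≤ x
      · filter_upwards [self_mem_nhdsWithin] with y hy
        exact ⟨fun _ => h, fun _ => h.trans (le_of_lt hy)⟩
      · push Not at h
        filter_upwards [nhdsWithin_le_nhds (Iio_mem_nhds h)] with y hy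
        constructor
        · intro h'; exact absurd h' (not_le.2 hy)
        · intro h'; exact absurd h' (not_le.2 h)
    filter_upwards [key (knot p n i), key (knot p n (i+1))] with y h1 h2
    rw [bspline, bspline]
    simp only [← not_le, h1, h2]
  | succ k ih =>
    intro i x
    have : bspline p n (k+1) i = fun x => _ := funext fun x => bs_succ p n k i x
    have d1 := ((((hasDerivAt_id x).sub_const (knot p n i)).mul_const
      (knot p n (i+k+1) - knot p n i)⁻¹).hasDerivWithinAt (s := Ioi x)).mul (ih i x)
    have d2 := ((((hasDerivAt_id x).const_sub (knot p n (i+k+2))).mul_const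
      (knot p n (i+k+2) - knot p n (i+1))⁻¹).hasDerivWithinAt (s := Ioi x)).mul (ih (i+1) x)
    rw [this]
    refine (d1.add d2).congr_deriv ?_
    simp only [bsD, id]
    rcases k with _ | k
    · simp; ring
    · simp only [Nat.add_sub_cancel]
      rw [bs_succ p n k i x, bs_succ p n k (i+1) x]
      simp only [show i+1+(k+1) = i+k+2 by ring, show i+1+(k+1)+1 = i+k+3 by ring,
        show i+1+1 = i+2 by ring, show i+(k+1+1)=i+k+2 by ring, show i+(k+1+1)+1=i+k+3 by ring,
        show i+(k+1) = i+k+1 by ring, show i+k+1+1 = i+k+2 by ring,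
        show i+k+1+2 = i+k+3 by ring,show i+1+k+1 = i+k+2 by ring, show i+1+k+2 = i+k+3 by ring,
        show i+k+2+1 = i+k+3 by ring]
      have hc : knot p n (i+k+2) = knot p n (i+1) ∨
          ((knot p n (i+k+2) - knot p n i) * (knot p n (i+k+2) - knot p n i)⁻¹ = 1 ∧
           (knot p n (i+k+3) - knot p n (i+1)) * (knot p n (i+k+3) - knot p n (i+1))⁻¹ = 1) := by
        have g1 := knot_mono p n hn (show i+1 ≤ i+k+2 by omega)
        have g2 := knot_mono p n hn (show i ≤ i+1 by omega)
        have g3 := knot_mono p n hn (show i+k+2 ≤ i+k+3 by omega)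
        rcases g1.lt_or_eq with h | h
        · right
          exact ⟨mul_inv_cancel₀ (by linarith), mul_inv_cancel₀ (by linarith)⟩
        · left; exact h.symm
      generalize (knot p n (i+k+2) - knot p n i)⁻¹ = A at *
      generalize (knot p n (i+k+3) - knot p n (i+1))⁻¹ = B at *
      generalize bspline p n k (i+1) x = M at *
      rcases hc with hc | ⟨hA, hB⟩
      · rw [hc]; simp; ring
      · push_cast
        linear_combination (k+1) * (knot p n (i+k+2) - knot p n (i+1))⁻¹ * M * (hB - hA)

lemma bs_cont1 (p n : ℕ) (hn : 1 ≤ n) (i : ℕ) : ContinuousOn (bspline p n 1 i) (Ico 0 1) := by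
  have g1 := knot_mono p n hn (show i ≤ i+1 by omega)
  have g2 := knot_mono p n hn (show i+1 ≤ i+2 by omega)
  have d1 := knot_double p n i hn
  have d2 := knot_double p n (i+1) hn
  have z0 := knot_nonneg p n i hn
  have z1 := knot_le_one p n (i+2) hn
  have e : ∀ x, bspline p n 1 i x = _ := fun x => bs_succ p n 0 i x
  generalize bspline p n 1 i = N at *
  simp only [bspline, add_zero, zero_add] at e
  simp only [show i+1+1 = i+2 by ring] at *
  generalize knot p n i = s at *
  generalize knot p n (i+1) = t at *
  generalize knot p n (i+2) = r at *
  rcases g1.lt_or_eq with h1 | h1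
  · rcases g2.lt_or_eq with h2 | h2
    · have : ContinuousOn (fun x => max 0 (min ((x-s)*(t-s)⁻¹) ((r-x)*(r-t)⁻¹))) (Ico 0 1) := by
        fun_prop
      refine this.congr fun x hx => ?_
      rw [e]
      have i1 : 0 < (t-s)⁻¹ := inv_pos.2 (by linarith)
      have i2 : 0 < (r-t)⁻¹ := inv_pos.2 (by linarith)
      have j1 : (t-s)*(t-s)⁻¹ = 1 := mul_inv_cancel₀ (by linarith)
      have j2 : (r-t)*(r-t)⁻¹ = 1 := mul_inv_cancel₀ (by linarith)
      generalize (t-s)⁻¹ = A at *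
      generalize (r-t)⁻¹ = B at *
      simp only
      rcases lt_or_ge x s with a | a
      · rw [if_neg (by rintro ⟨_, _⟩; linarith), if_neg (by rintro ⟨_, _⟩; linarith)]
        rw [max_eq_left]; · simp
        exact (min_le_left _ _).trans (by nlinarith)
      rcases lt_or_ge x t with b | b
      · rw [if_pos ⟨a, b⟩, if_neg (by rintro ⟨_, _⟩; linarith)]
        rw [min_eq_left, max_eq_right]
        · ring
        · nlinarith
        · have : (x-s)*A ≤ 1 := by nlinarith
          have : 1 ≤ (r-x)*B := by nlinarith
          linarith
      rcases lt_or_ge x r with c | c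
      · rw [if_neg (by rintro ⟨_, _⟩; linarith), if_pos ⟨b, c⟩]
        rw [min_eq_right, max_eq_right]
        · ring
        · nlinarith
        · have : 1 ≤ (x-s)*A := by nlinarith
          have : (r-x)*B ≤ 1 := by nlinarith
          linarith
      · rw [if_neg (by rintro ⟨_, _⟩; linarith), if_neg (by rintro ⟨_, _⟩; linarith)]
        rw [max_eq_left]; · simp
        exact (min_le_right _ _).trans (by nlinarith)
    · have ht : t = 1 := by
        rcases d2 h2 with h | h
        · linarith
        · exact h
      have : ContinuousOn (fun x => max 0 ((x-s)*(t-s)⁻¹)) (Ico 0 1) := by fun_prop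
      refine this.congr fun x hx => ?_
      rw [e]
      have i1 : 0 < (t-s)⁻¹ := inv_pos.2 (by linarith)
      generalize (t-s)⁻¹ = A at *
      have hx2 := hx.2
      rw [if_neg (c := t ≤ x ∧ x < r) (by rintro ⟨_, _⟩; linarith)]
      simp only
      rcases lt_or_ge x s with a | a
      · rw [if_neg (by rintro ⟨_, _⟩; linarith), max_eq_left (by nlinarith)]; simp
      · rw [if_pos ⟨a, by linarith⟩, max_eq_right (by nlinarith)]; simp
  · rcases d1 h1 with h0 | h0
    · have : ContinuousOn (fun x => max 0 ((r-x)*(r-t)⁻¹)) (Ico 0 1) := by fun_prop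
      refine this.congr fun x hx => ?_
      rw [e]
      rw [if_neg (c := s ≤ x ∧ x < t) (by rintro ⟨_, _⟩; linarith)]
      have hx1 := hx.1
      simp only
      rcases g2.lt_or_eq with h2 | h2
      · have i2 : 0 < (r-t)⁻¹ := inv_pos.2 (by linarith)
        generalize (r-t)⁻¹ = B at *
        rcases lt_or_ge x r with a | a
        · rw [if_pos ⟨by linarith, a⟩, max_eq_right (by nlinarith)]; simp
        · rw [if_neg (by rintro ⟨_, _⟩; linarith), max_eq_left (by nlinarith)]; simp
      · simp [h2]
    · refine (continuousOn_const (c := (0:ℝ))).congr fun x hx => ?_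
      have hx2 := hx.2
      rw [e, if_neg (by rintro ⟨_, _⟩; linarith), if_neg (by rintro ⟨_, _⟩; linarith)]
      simp

lemma bs_cont (p n : ℕ) (hn : 1 ≤ n) (k : ℕ) : ∀ i, ContinuousOn (bspline p n (k+1) i) (Ico 0 1) := by
  induction k with
  | zero => exact bs_cont1 p n hn
  | succ k ih =>
    intro i
    have : bspline p n (k+1+1) i = fun x => _ := funext fun x => bs_succ p n (k+1) i x
    rw [this]
    have h1 := ih i
    have h2 := ih (i+1)
    fun_prop

lemma bs_ftc (p n : ℕ) (hn : 1 ≤ n) (k i : ℕ) (x : ℝ) (hx : x ∈ Ico (0:ℝ) 1) :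
    bspline p n (k+1) i x = bspline p n (k+1) i 0 +
      ((k+1) * ((knot p n (i+k+1) - knot p n i)⁻¹ / n) * (n * ∫ y in (0:ℝ)..x, bspline p n k i y) +
       (-((k+1) * ((knot p n (i+k+2) - knot p n (i+1))⁻¹ / n))) *
        (n * ∫ y in (0:ℝ)..x, bspline p n k (i+1) y)) := by
  have hn' : (n:ℝ) ≠ 0 := by positivity
  have I1 := bs_int p n hn k i 0 x
  have I2 := bs_int p n hn k (i+1) 0 x
  have hD : bsD p n (k+1) i = fun y => ((k+1) * (knot p n (i+k+1) - knot p n i)⁻¹) * bspline p n k i y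
      - ((k+1) * (knot p n (i+k+2) - knot p n (i+1))⁻¹) * bspline p n k (i+1) y := by
    ext y
    simp only [bsD, Nat.add_sub_cancel]
    rw [show i+(k+1)+1 = i+k+2 by ring, show i+(k+1)=i+k+1 by ring]
    push_cast; ring
  have := intervalIntegral.integral_eq_sub_of_hasDeriv_right (a := 0) (b := x) (f := bspline p n (k+1) i)
    (f' := bsD p n (k+1) i) ((bs_cont p n hn k i).mono (by
      rw [uIcc_of_le hx.1]; intro y hy; exact ⟨hy.1, hy.2.trans_lt hx.2⟩))
    (fun y _ => bs_deriv p n hn (k+1) i y) (by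
      rw [hD]; exact (I1.const_mul _).sub (I2.const_mul _))
  rw [hD, intervalIntegral.integral_sub (I1.const_mul _) (I2.const_mul _), intervalIntegral.integral_const_mul, intervalIntegral.integral_const_mul] at this
  rw [eq_sub_iff_add_eq] at this
  rw [← this]
  field_simp
  ring
noncomputable def tp (l : ℕ) (t : ℝ) : ℝ := if 0 ≤ t then t^l else 0

lemma tp_mono (l : ℕ) : Monotone (tp l) := by
  intro a b h
  unfold tp
  split_ifs with h1 h2 h2
  · gcongr
  · linarith
  · positivity
  · rfl

lemma tp_int (l : ℕ) (ξ a b : ℝ) : IntervalIntegrable (fun y => tp l (y - ξ)) volume a b := by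
  apply Monotone.intervalIntegrable
  intro x y h
  exact tp_mono l (by linarith)

lemma tp_integral (l : ℕ) (ξ x : ℝ) (h0 : 0 ≤ ξ) (hx : 0 ≤ x) :
    ∫ y in (0:ℝ)..x, tp l (y - ξ) = (1/((l:ℝ)+1)) * tp (l+1) (x - ξ) := by
  have hz : ∀ b, b ≤ ξ → 0 ≤ b → ∫ y in (0:ℝ)..b, tp l (y - ξ) = 0 := by
    intro b hb hb0
    rw [intervalIntegral.integral_congr_Ioo_of_le (g := fun _ => 0) hb0]
    · simp
    · intro y hy
      simp only [tp]
      rw [if_neg]; have := hy.2; linarith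
  rcases le_or_gt x ξ with h | h
  · rw [hz x h hx]
    unfold tp
    split_ifs with h'
    · have : x - ξ = 0 := by linarith
      simp [this]
    · simp
  · rw [← intervalIntegral.integral_add_adjacent_intervals (tp_int l ξ 0 ξ) (tp_int l ξ ξ x), hz ξ le_rfl h0]
    rw [intervalIntegral.integral_congr (g := fun y => (y-ξ)^l)]
    · rw [intervalIntegral.integral_comp_sub_right (fun y => y^l), integral_pow]
      unfold tp
      rw [if_pos (by linarith)]
      simp; ring
    · intro y hy
      rw [uIcc_of_le h.le] at hy
      simp only [tp]
      rw [if_pos]; have := hy.1; linarith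

inductive TRep (n : ℕ) (a b : ℝ) (lo k : ℕ) : ℝ → (ℝ → ℝ) → Prop
  | atom (l : ℕ) (ξ : ℝ) (h1 : lo ≤ l) (h2 : l ≤ k) (h3 : 0 ≤ ξ) (h4 : ξ ≤ 1) (h5 : a ≤ ξ)
      (h6 : ξ ≤ b) (h7 : ξ = 0 ∨ l = k) : TRep n a b lo k 1 (fun x => (n:ℝ)^l * tp l (x - ξ))
  | add (C D : ℝ) (u v : ℝ → ℝ) (hu : TRep n a b lo k C u) (hv : TRep n a b lo k D v) :
      TRep n a b lo k (C + D) (fun x => u x + v x)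
  | smul (t C : ℝ) (u : ℝ → ℝ) (hu : TRep n a b lo k C u) :
      TRep n a b lo k (|t| * C) (fun x => t * u x)
  | congr (C : ℝ) (u v : ℝ → ℝ) (hu : TRep n a b lo k C u) (h : ∀ x ∈ Ico (0:ℝ) 1, v x = u x) :
      TRep n a b lo k C v
  | mono (C D : ℝ) (u : ℝ → ℝ) (hu : TRep n a b lo k C u) (h : C ≤ D) : TRep n a b lo k D u

lemma TRep.nonneg {n : ℕ} {a b : ℝ} {lo k : ℕ} {C : ℝ} {u : ℝ → ℝ} (h : TRep n a b lo k C u) :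
    0 ≤ C := by
  induction h with
  | atom => norm_num
  | add => linarith
  | smul => positivity
  | congr => assumption
  | mono => linarith

lemma TRep.weaken {n : ℕ} {a b a' b' : ℝ} {lo lo' k : ℕ} {C : ℝ} {u : ℝ → ℝ}
    (h : TRep n a b lo k C u) (ha : a' ≤ a) (hb : b ≤ b') (hl : lo' ≤ lo) :
    TRep n a' b' lo' k C u := by
  induction h with
  | atom l ξ h1 h2 h3 h4 h5 h6 h7 =>
    exact .atom l ξ (hl.trans h1) h2 h3 h4 (ha.trans h5) (h6.trans hb) h7
  | add C D u v _ _ h1 h2 => exact .add C D u v h1 h2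
  | smul t C u _ h => exact .smul t C u h
  | congr C u v _ h1 h2 => exact .congr C u v h2 h1
  | mono C D u _ h1 h2 => exact .mono C D u h2 h1

lemma TRep.int {n : ℕ} {a b : ℝ} {lo k : ℕ} {C : ℝ} {u : ℝ → ℝ}
    (h : TRep n a b lo k C u) (x : ℝ) (hx : x ∈ Ico (0:ℝ) 1) : IntervalIntegrable u volume 0 x := by
  induction h with
  | atom l ξ h1 h2 h3 h4 h5 h6 h7 => exact (tp_int l ξ 0 x).const_mul _
  | add C D u v _ _ h1 h2 => exact h1.add h2
  | smul t C u _ h => exact h.const_mul _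
  | congr C u v _ h1 h2 =>
    refine h2.congr ?_
    intro y hy
    rw [uIoc_of_le hx.1] at hy
    exact (h1 y ⟨hy.1.le, hy.2.trans_lt hx.2⟩).symm
  | mono C D u _ h1 h2 => exact h2

lemma TRep.integ {n : ℕ} {a b : ℝ} {lo k : ℕ} {C : ℝ} {u : ℝ → ℝ}
    (h : TRep n a b lo k C u) : TRep n a b (lo+1) (k+1) C (fun x => n * ∫ y in (0:ℝ)..x, u y) := by
  induction h with
  | atom l ξ h1 h2 h3 h4 h5 h6 h7 =>
    have := TRep.smul (1/((l:ℝ)+1)) _ _ (TRep.atom (n := n) (a := a) (b := b) (lo := lo+1) (k := k+1)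
      (l+1) ξ (by omega) (by omega) h3 h4 h5 h6 (h7.imp id (by omega)))
    refine .mono _ _ _ (.congr _ _ _ this ?_) ?_
    · intro x hx
      rw [intervalIntegral.integral_const_mul, tp_integral l ξ x h3 hx.1]
      ring
    · rw [abs_of_nonneg (by positivity), mul_one]
      rw [div_le_one (by positivity)]
      have : (0:ℝ) ≤ l := by positivity
      linarith
  | add C D u v r1 r2 h1 h2 =>
    refine .congr _ _ _ (.add _ _ _ _ h1 h2) ?_
    intro x hx
    rw [intervalIntegral.integral_add (r1.int x hx) (r2.int x hx)]; ring
  | smul t C u _ h =>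
    refine .congr _ _ _ (.smul t _ _ h) ?_
    intro x hx
    rw [intervalIntegral.integral_const_mul]; ring
  | congr C u v _ h1 h2 =>
    refine .congr _ _ _ h2 ?_
    intro x hx
    congr 1
    refine intervalIntegral.integral_congr fun y hy => ?_
    rw [uIcc_of_le hx.1] at hy
    exact (h1 y ⟨hy.1, hy.2.trans_lt hx.2⟩)
  | mono C D u _ h1 h2 => exact .mono _ _ _ h2 h1

lemma bs_rep_step (p n : ℕ) (hn : 1 ≤ n) (k i : ℕ) (C : ℝ)
    (h : ∀ i, TRep n (knot p n i) (knot p n (i+k+1)) 0 k C (bspline p n k i)) :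
    TRep n (knot p n i) (knot p n (i+k+2)) 1 (k+1) (2*(k+1)*C)
      (fun x => bspline p n (k+1) i x - bspline p n (k+1) i 0) := by
  have C0 := (h 0).nonneg
  have r1 := ((h i).integ).weaken (le_refl (knot p n i))
    (knot_mono p n hn (show i+k+1 ≤ i+k+2 by omega)) (le_refl 1)
  have r2 := ((h (i+1)).integ).weaken (knot_mono p n hn (show i ≤ i+1 by omega))
    (knot_mono p n hn (show i+1+k+1 ≤ i+k+2 by omega)) (le_refl 1)
  have r := TRep.add _ _ _ _
    (TRep.smul ((k+1) * ((knot p n (i+k+1) - knot p n i)⁻¹ / n)) _ _ r1)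
    (TRep.smul (-((k+1) * ((knot p n (i+k+2) - knot p n (i+1))⁻¹ / n))) _ _ r2)
  refine .mono _ _ _ (.congr _ _ _ r ?_) ?_
  · intro x hx
    rw [bs_ftc p n hn k i x hx]; ring
  · have k1 := knot_inv p n hn (show i ≤ i+k+1 by omega)
    have k2 := knot_inv p n hn (show i+1 ≤ i+k+2 by omega)
    rw [abs_neg, abs_mul, abs_mul, abs_of_nonneg (show (0:ℝ) ≤ k+1 by positivity)]
    calc _ ≤ ((k:ℝ)+1)*1*C + (k+1)*1*C := by gcongr
      _ = _ := by ring

lemma bs_rep (p k : ℕ) : ∃ C : ℝ, ∀ n, 1 ≤ n → ∀ i,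
    TRep n (knot p n i) (knot p n (i+k+1)) 0 k C (bspline p n k i) := by
  induction k with
  | zero =>
    refine ⟨2, fun n hn i => ?_⟩
    have g := knot_mono p n hn (show i ≤ i+1 by omega)
    have a1 := TRep.atom (n := n) (a := knot p n i) (b := knot p n (i+1)) (lo := 0) (k := 0) 0 (knot p n i)
      le_rfl le_rfl (knot_nonneg p n i hn) (knot_le_one p n i hn) le_rfl g (Or.inr rfl)
    have a2 := TRep.atom (n := n) (a := knot p n i) (b := knot p n (i+1)) (lo := 0) (k := 0) 0 (knot p n (i+1))
      le_rfl le_rfl (knot_nonneg p n _ hn) (knot_le_one p n _ hn) g le_rfl (Or.inr rfl)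
    refine .mono _ _ _ (.congr _ _ _ (.add _ _ _ _ a1 (.smul (-1) _ _ a2)) ?_) ?_
    · intro x hx
      simp only [bspline, tp, pow_zero, sub_nonneg]
      split_ifs <;> grind
    · norm_num
  | succ k ih =>
    obtain ⟨C, hC⟩ := ih
    refine ⟨2*(k+1)*C + 2^(k+1), fun n hn i => ?_⟩
    have st := (bs_rep_step p n hn k i C (hC n hn)).weaken le_rfl le_rfl (Nat.zero_le 1)
    rcases (knot_nonneg p n i hn).lt_or_eq with h | h
    · refine .mono _ _ _ (.congr _ _ _ st ?_) ?_
      · intro x hx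
        rw [bs_supp p n hn (k+1) i 0 (Or.inl h)]; simp
      · have : (0:ℝ) ≤ 2^(k+1) := by positivity
        linarith
    · have a := TRep.atom (n := n) (a := knot p n i) (b := knot p n (i+k+2)) (lo := 0) (k := k+1) 0 0
        le_rfl (by omega) le_rfl zero_le_one h.symm.le (knot_nonneg p n _ hn) (Or.inl rfl)
      refine .mono _ _ _ (.congr _ _ _ (.add _ _ _ _ st (.smul (bspline p n (k+1) i 0) _ _ a)) ?_) ?_
      · intro x hx
        simp [tp, hx.1]
      · have := bs_bound p n hn (k+1) i 0
        linarith

lemma bs_rep1 (p : ℕ) (hp : 1 ≤ p) : ∃ C : ℝ, ∀ n, 1 ≤ n → ∀ j, 2 ≤ j →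
    TRep n (knot p n j) (knot p n (j+p+1)) 1 p C (bspline p n p j) := by
  obtain ⟨k, rfl⟩ : ∃ k, p = k+1 := ⟨p-1, by omega⟩
  obtain ⟨C, hC⟩ := bs_rep (k+1) k
  refine ⟨2*(k+1)*C, fun n hn j hj => ?_⟩
  refine .congr _ _ _ (bs_rep_step (k+1) n hn k j C (hC n hn)) ?_
  intro x hx
  rw [bs_zero (k+1) n hn (k+1) j (by omega)]; simp
lemma mp_deriv (s t : ℝ) (h : 1 < s ∨ 0 < t) :
    HasDerivAt (fun t : ℝ => (max t 0)^s) (s * (max t 0)^(s-1)) t := by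
  rcases lt_trichotomy t 0 with ht | ht | ht
  · have hs : 1 < s := by
      rcases h with h | h
      · exact h
      · linarith
    rw [max_eq_right ht.le, Real.zero_rpow (by linarith), mul_zero]
    refine (hasDerivAt_const t (0:ℝ)).congr_of_eventuallyEq ?_
    filter_upwards [Iio_mem_nhds ht] with y hy
    rw [max_eq_right (le_of_lt hy), Real.zero_rpow (by linarith)]
  · have hs : 1 < s := by
      rcases h with h | h
      · exact h
      · linarith
    subst ht
    have d1 : HasDerivWithinAt (fun t : ℝ => (max t 0)^s) (s * (max 0 0)^(s-1)) (Ici 0) 0 := by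
      have := (Real.hasDerivAt_rpow_const (x := 0) (p := s) (Or.inr hs.le)).hasDerivWithinAt (s := Ici 0)
      refine (this.congr (fun y hy => ?_) ?_).congr_deriv ?_
      · rw [max_eq_left hy]
      · simp
      · simp
    have d2 : HasDerivWithinAt (fun t : ℝ => (max t 0)^s) (s * (max 0 0)^(s-1)) (Iic 0) 0 := by
      have := (hasDerivAt_const (0:ℝ) (0:ℝ)).hasDerivWithinAt (s := Iic 0)
      refine (this.congr (fun y hy => ?_) ?_).congr_deriv ?_
      · rw [max_eq_right hy, Real.zero_rpow (by linarith)]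
      · rw [max_self, Real.zero_rpow (by linarith)]
      · rw [max_self, Real.zero_rpow (by linarith), mul_zero]
    have := d1.union d2
    rw [union_comm, Iic_union_Ici] at this
    exact this.hasDerivAt Filter.univ_mem
  · rw [max_eq_left ht.le]
    refine (Real.hasDerivAt_rpow_const (Or.inl ht.ne')).congr_of_eventuallyEq ?_
    filter_upwards [Ioi_mem_nhds ht] with y hy
    rw [max_eq_left (le_of_lt hy)]

lemma tp_max (l : ℕ) (hl : 1 ≤ l) (t : ℝ) : tp l t = (max t 0)^l := by
  unfold tp
  split_ifs with h
  · rw [max_eq_left h]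
  · rw [max_eq_right (by linarith), zero_pow (by omega)]

lemma ker_int (β : ℝ) (hβ : -1 < β) (a b z : ℝ) :
    IntervalIntegrable (fun y => (z - y)^β) volume a b := by
  have := (intervalIntegral.intervalIntegrable_rpow' (a := z - a) (b := z - b) hβ).comp_sub_left z
  simpa using this

lemma atom_int (β : ℝ) (hβ : -1 < β) (l : ℕ) (hl : 1 ≤ l) (ξ a b z : ℝ) :
    IntervalIntegrable (fun y => (z-y)^β * tp l (y - ξ)) volume a b := by
  refine (ker_int β hβ a b z).mul_continuousOn ?_
  simp only [tp_max l hl]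
  fun_prop

noncomputable def Bc (β : ℝ) (l : ℕ) : ℝ := ∫ s in (0:ℝ)..1, (1-s)^β * s^l

lemma atom_val (β : ℝ) (hβ : -1 < β) (l : ℕ) (hl : 1 ≤ l) (ξ z : ℝ) (h0 : 0 ≤ ξ) (hz : 0 < z) :
    ∫ y in (0:ℝ)..z, (z-y)^β * tp l (y - ξ) = Bc β l * (max (z - ξ) 0)^(β + l + 1) := by
  have hl' : (1:ℝ) ≤ l := by exact_mod_cast hl
  have hzero : ∀ b, b ≤ ξ → 0 ≤ b → ∫ y in (0:ℝ)..b, (z-y)^β * tp l (y - ξ) = 0 := by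
    intro b hb hb0
    rw [intervalIntegral.integral_congr_Ioo_of_le (g := fun _ => 0) hb0]
    · simp
    · intro y hy
      simp only [tp]
      rw [if_neg, mul_zero]; have := hy.2; linarith
  rcases le_or_gt z ξ with h | h
  · rw [hzero z h hz.le, max_eq_right (by linarith), Real.zero_rpow (by linarith), mul_zero]
  · rw [← intervalIntegral.integral_add_adjacent_intervals (atom_int β hβ l hl ξ 0 ξ z)
      (atom_int β hβ l hl ξ ξ z z), hzero ξ le_rfl h0, zero_add, max_eq_left (by linarith)]
    have hc : 0 < z - ξ := by linarith
    have := intervalIntegral.integral_comp_mul_add (a := 0) (b := 1)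
      (fun y => (z-y)^β * tp l (y - ξ)) hc.ne' ξ
    rw [show (z-ξ)*0+ξ = ξ by ring, show (z-ξ)*1+ξ = z by ring, smul_eq_mul,
      eq_inv_mul_iff_mul_eq₀ hc.ne'] at this
    rw [← this]
    rw [intervalIntegral.integral_congr (g := fun s => (z-ξ)^(β+l) * ((1-s)^β * s^l))]
    · rw [intervalIntegral.integral_const_mul, Real.rpow_add_one hc.ne']
      unfold Bc; ring
    · intro s hs
      rw [uIcc_of_le zero_le_one] at hs
      beta_reduce
      rw [show z - ((z-ξ)*s+ξ) = (z-ξ)*(1-s) by ring, show (z-ξ)*s+ξ-ξ = (z-ξ)*s by ring,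
        Real.mul_rpow hc.le (by linarith [hs.2]), tp, if_pos (mul_nonneg hc.le hs.1), mul_pow,
        Real.rpow_add hc, Real.rpow_natCast]
      ring

noncomputable def Kc (p : ℕ) (α : ℝ) : ℝ :=
  ((p:ℝ)+2)^(p:ℝ) * ∑ l ∈ Finset.range (p+1), |Bc (1-α) l * ((l+2-α) * (l+1-α))|

lemma rep_main (p : ℕ) (hp : 2 ≤ p) (α : ℝ) (h1 : 1 < α) (h2 : α < 2) (n : ℕ) (hn : 1 ≤ n)
    (a b C : ℝ) (hb : b ≤ a + (p+1)/n) (u : ℝ → ℝ) (h : TRep n a b 1 p C u) :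
    (∀ z ∈ Ioo (0:ℝ) 1, IntervalIntegrable (fun y => (z-y)^(1-α) * u y) volume 0 z) ∧
    ∃ G H : ℝ → ℝ, ∀ z ∈ Ioo (0:ℝ) 1,
      HasDerivAt (fun z => ∫ y in (0:ℝ)..z, (z - y) ^ (1 - α) * u y) (G z) z ∧
      HasDerivAt G (H z) z ∧ (z ≤ a → H z = 0) ∧
      (1/(n*p) ≤ z → z ≤ b + 1/n → |H z| ≤ C * (Kc p α * (n:ℝ)^α)) := by
  have hn' : (0:ℝ) < n := by positivity
  have hp' : (2:ℝ) ≤ p := by exact_mod_cast hp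
  induction h with
  | atom l ξ l1 l2 l3 l4 l5 l6 l7 =>
    have hl' : (1:ℝ) ≤ l := by exact_mod_cast l1
    refine ⟨fun z hz => ?_, fun z => (n:ℝ)^l * (Bc (1-α) l * ((l+2-α) * (max (z-ξ) 0)^(l+1-α))),
      fun z => (n:ℝ)^l * (Bc (1-α) l * ((l+2-α) * ((l+1-α) * (max (z-ξ) 0)^(l-α)))), ?_⟩
    · refine ((atom_int (1-α) (by linarith) l l1 ξ 0 z z).const_mul ((n:ℝ)^l)).congr ?_
      intro y _; beta_reduce; ring
    intro z hz
    have hcase : 1 < (l:ℝ)+1-α ∨ 0 < z - ξ := by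
      rcases l7 with h | h
      · right; rw [h]; simpa using hz.1
      · left; rw [h]; linarith
    refine ⟨?_, ?_, ?_, ?_⟩
    · have d := ((mp_deriv (l+2-α) (z-ξ) (Or.inl (by linarith))).comp_sub_const z ξ).const_mul ((n:ℝ)^l * Bc (1-α) l)
      refine (d.congr_of_eventuallyEq ?_).congr_deriv ?_
      · filter_upwards [Ioi_mem_nhds hz.1] with w hw
        rw [← show (1-α)+(l:ℝ)+1 = l+2-α by ring, mul_assoc, ← atom_val (1-α) (by linarith) l l1 ξ w l3 hw,
          ← intervalIntegral.integral_const_mul]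
        refine intervalIntegral.integral_congr fun y _ => ?_
        beta_reduce; ring
      · rw [show (l:ℝ)+2-α-1 = l+1-α by ring]; ring
    · have d := ((mp_deriv (l+1-α) (z-ξ) hcase).comp_sub_const z ξ).const_mul ((n:ℝ)^l * Bc (1-α) l * (l+2-α))
      refine (d.congr_of_eventuallyEq ?_).congr_deriv ?_
      · filter_upwards with w
        ring
      · rw [show (l:ℝ)+1-α-1 = l-α by ring]; ring
    · intro hza
      beta_reduce
      rw [max_eq_right (by linarith), Real.zero_rpow, mul_zero]; · simp
      rcases hcase with h | h
      · linarith
      · linarith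
    · intro hz1 hz2
      have key : (n:ℝ)^l * (max (z-ξ) 0)^(l-α) ≤ ((p:ℝ)+2)^(p:ℝ) * (n:ℝ)^α := by
        rw [← Real.rpow_natCast (n:ℝ) l]
        by_cases hl2 : l = 1
        · subst hl2
          have hξ : ξ = 0 := by
            rcases l7 with h | h
            · exact h
            · omega
          subst hξ
          rw [sub_zero, max_eq_left hz.1.le]
          have hnp : (0:ℝ) < 1/(n*p) := by positivity
          have e1 : z^((1:ℕ)-α) ≤ (1/(n*p:ℝ))^((1:ℕ)-α) :=
            Real.rpow_le_rpow_of_nonpos hnp hz1 (by push_cast; linarith)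
          have e2 : (1/(n*p:ℝ))^((1:ℕ)-α) = (n:ℝ)^(α-1) * (p:ℝ)^(α-1) := by
            rw [one_div, Real.inv_rpow (by positivity), ← Real.rpow_neg (by positivity),
              Real.mul_rpow (by positivity) (by positivity)]
            push_cast; rw [neg_sub]
          have e3 : (p:ℝ)^(α-1) ≤ ((p:ℝ)+2)^(p:ℝ) := by
            calc (p:ℝ)^(α-1) ≤ ((p:ℝ)+2)^(α-1) :=
                  Real.rpow_le_rpow (by positivity) (by linarith) (by linarith)
              _ ≤ _ := Real.rpow_le_rpow_of_exponent_le (by linarith) (by linarith)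
          calc _ ≤ (n:ℝ)^((1:ℕ):ℝ) * ((n:ℝ)^(α-1) * (p:ℝ)^(α-1)) := by rw [← e2]; gcongr
            _ = (p:ℝ)^(α-1) * (n:ℝ)^α := by
              rw [← mul_assoc, ← Real.rpow_add hn']; push_cast; rw [show 1+(α-1) = α by ring]; ring
            _ ≤ _ := by gcongr
        · have hl2' : (2:ℝ) ≤ l := by exact_mod_cast (show 2 ≤ l by omega)
          have l2' : (l:ℝ) ≤ p := by exact_mod_cast l2
          have hm : max (z-ξ) 0 ≤ ((p:ℝ)+2)/n := by
            refine max_le ?_ (by positivity)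
            have : ((p:ℝ)+2)/n = (p+1)/n + 1/n := by ring
            linarith
          have e3 : ((p:ℝ)+2)^((l:ℝ)-α) ≤ ((p:ℝ)+2)^(p:ℝ) :=
            Real.rpow_le_rpow_of_exponent_le (by linarith) (by linarith)
          calc _ ≤ (n:ℝ)^(l:ℝ) * (((p:ℝ)+2)/n)^((l:ℝ)-α) := by
                have := Real.rpow_le_rpow (le_max_right _ _) hm (show 0 ≤ (l:ℝ)-α by linarith)
                gcongr
            _ = ((p:ℝ)+2)^((l:ℝ)-α) * (n:ℝ)^α := by
              rw [Real.div_rpow (by positivity) (by positivity), Real.rpow_sub hn']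
              field_simp
            _ ≤ _ := by gcongr
      have key2 : |Bc (1-α) l * ((l+2-α) * (l+1-α))| ≤
          ∑ l ∈ Finset.range (p+1), |Bc (1-α) l * ((l+2-α) * (l+1-α))| :=
        Finset.single_le_sum (f := fun l : ℕ => |Bc (1-α) l * (((l:ℝ)+2-α) * (l+1-α))|)
          (fun _ _ => abs_nonneg _) (Finset.mem_range.2 (by omega))
      have h0 : 0 ≤ (n:ℝ)^l * (max (z-ξ) 0)^(l-α) := by positivity
      beta_reduce
      rw [show (n:ℝ)^l * (Bc (1-α) l * ((l+2-α) * ((l+1-α) * (max (z-ξ) 0)^(l-α)))) =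
        ((n:ℝ)^l * (max (z-ξ) 0)^(l-α)) * (Bc (1-α) l * ((l+2-α) * (l+1-α))) by ring, abs_mul,
        abs_of_nonneg h0]
      unfold Kc
      calc _ ≤ (((p:ℝ)+2)^(p:ℝ) * (n:ℝ)^α) * ∑ l ∈ Finset.range (p+1), |Bc (1-α) l * ((l+2-α) * (l+1-α))| := by
            gcongr
        _ = _ := by ring
  | add C D u v r1 r2 i1 i2 =>
    obtain ⟨I1, G1, H1, P1⟩ := i1
    obtain ⟨I2, G2, H2, P2⟩ := i2
    refine ⟨fun z hz => ?_, fun z => G1 z + G2 z, fun z => H1 z + H2 z, fun z hz => ?_⟩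
    · refine ((I1 z hz).add (I2 z hz)).congr ?_
      intro y _; beta_reduce; ring
    · obtain ⟨a1, a2, a3, a4⟩ := P1 z hz
      obtain ⟨b1, b2, b3, b4⟩ := P2 z hz
      refine ⟨?_, a2.add b2, ?_, ?_⟩
      · refine (a1.add b1).congr_of_eventuallyEq ?_
        filter_upwards [Ioo_mem_nhds hz.1 hz.2] with w hw
        rw [Pi.add_apply, ← intervalIntegral.integral_add (I1 w hw) (I2 w hw)]
        refine intervalIntegral.integral_congr fun y _ => ?_
        beta_reduce; ring
      · intro h; beta_reduce; rw [a3 h, b3 h, add_zero]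
      · intro x1 x2
        refine (abs_add_le _ _).trans ?_
        rw [add_mul]
        exact add_le_add (a4 x1 x2) (b4 x1 x2)
  | smul t C u r1 i1 =>
    obtain ⟨I1, G1, H1, P1⟩ := i1
    refine ⟨fun z hz => ?_, fun z => t * G1 z, fun z => t * H1 z, fun z hz => ?_⟩
    · refine ((I1 z hz).const_mul t).congr ?_
      intro y _; beta_reduce; ring
    · obtain ⟨a1, a2, a3, a4⟩ := P1 z hz
      refine ⟨?_, a2.const_mul t, ?_, ?_⟩
      · refine (a1.const_mul t).congr_of_eventuallyEq ?_
        filter_upwards with w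
        rw [← intervalIntegral.integral_const_mul]
        refine intervalIntegral.integral_congr fun y _ => ?_
        beta_reduce; ring
      · intro h; beta_reduce; rw [a3 h, mul_zero]
      · intro x1 x2
        rw [abs_mul, mul_assoc]
        exact mul_le_mul_of_nonneg_left (a4 x1 x2) (abs_nonneg _)
  | congr C u v r1 h i1 =>
    obtain ⟨I1, G1, H1, P1⟩ := i1
    refine ⟨fun z hz => ?_, G1, H1, fun z hz => ?_⟩
    · refine (I1 z hz).congr ?_
      intro y hy
      rw [uIoc_of_le hz.1.le] at hy
      beta_reduce
      rw [h y ⟨hy.1.le, hy.2.trans_lt hz.2⟩]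
    · obtain ⟨a1, a2, a3, a4⟩ := P1 z hz
      refine ⟨?_, a2, a3, a4⟩
      refine a1.congr_of_eventuallyEq ?_
      filter_upwards [Ioo_mem_nhds hz.1 hz.2] with w hw
      refine intervalIntegral.integral_congr fun y hy => ?_
      rw [uIcc_of_le hw.1.le] at hy
      beta_reduce
      rw [h y ⟨hy.1, hy.2.trans_lt hw.2⟩]
  | mono C D u r1 h i1 =>
    obtain ⟨I1, G1, H1, P1⟩ := i1
    refine ⟨I1, G1, H1, fun z hz => ?_⟩
    obtain ⟨a1, a2, a3, a4⟩ := P1 z hz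
    refine ⟨a1, a2, a3, fun x1 x2 => (a4 x1 x2).trans ?_⟩
    have : 0 ≤ Kc p α * (n:ℝ)^α := by
      unfold Kc
      have := Finset.sum_nonneg (s := Finset.range (p+1)) (f := fun l : ℕ => |Bc (1-α) l * (((l:ℝ)+2-α) * (l+1-α))|) (fun _ _ => abs_nonneg _)
      positivity
    gcongr

lemma Kc_nonneg (p : ℕ) (α : ℝ) : 0 ≤ Kc p α := by
  unfold Kc
  have := Finset.sum_nonneg (s := Finset.range (p+1)) (f := fun l : ℕ => |Bc (1-α) l * (((l:ℝ)+2-α) * (l+1-α))|) (fun _ _ => abs_nonneg _)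
  positivity

lemma far_deriv (β : ℝ) (hβ : β ≤ 1) (u : ℝ → ℝ) (hu : Measurable u) (M : ℝ) (hM : ∀ y, |u y| ≤ M)
    (a b z : ℝ) (hab : a ≤ b) (hz : b < z) :
    HasDerivAt (fun w => ∫ y in a..b, (w-y)^β * u y) (∫ y in a..b, β * (z-y)^(β-1) * u y) z := by
  have M0 : 0 ≤ M := (abs_nonneg _).trans (hM 0)
  have hc : ∀ (w γ : ℝ), b < w → ContinuousOn (fun y => (w-y)^γ) (uIcc a b) := by
    intro w γ hw
    rw [uIcc_of_le hab]
    refine ContinuousOn.rpow_const (by fun_prop) ?_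
    intro y hy; left
    have := hy.2; linarith
  have hui : IntervalIntegrable u volume a b := by
    refine (intervalIntegrable_const (c := M)).mono_fun hu.aestronglyMeasurable ?_
    filter_upwards with x
    simpa [abs_of_nonneg M0] using hM x
  refine (intervalIntegral.hasDerivAt_integral_of_dominated_loc_of_deriv_le
    (s := Ioi ((z+b)/2)) (bound := fun _ => |β| * ((z-b)/2)^(β-1) * M)
    (F := fun w y => (w-y)^β * u y) (F' := fun w y => β * (w-y)^(β-1) * u y)
    (Ioi_mem_nhds (by linarith)) ?_ ?_ ?_ ?_ ?_ ?_).2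
  · filter_upwards with w
    have : Measurable fun y => (w-y)^β * u y := by fun_prop
    exact this.aestronglyMeasurable
  · exact hui.continuousOn_mul (hc z β hz)
  · have : Measurable fun y => β * (z-y)^(β-1) * u y := by fun_prop
    exact this.aestronglyMeasurable
  · filter_upwards with y hy w hw
    rw [uIoc_of_le hab] at hy
    have hw' : (z+b)/2 < w := hw
    have hy2 := hy.2
    have : (w-y)^(β-1) ≤ ((z-b)/2)^(β-1) :=
      Real.rpow_le_rpow_of_nonpos (by linarith) (by linarith) (by linarith)
    have h0 : 0 ≤ (w-y)^(β-1) := Real.rpow_nonneg (by linarith) _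
    rw [Real.norm_eq_abs, abs_mul, abs_mul, abs_of_nonneg h0]
    have := hM y
    gcongr
  · exact intervalIntegrable_const
  · filter_upwards with y hy w hw
    rw [uIoc_of_le hab] at hy
    have hw' : (z+b)/2 < w := hw
    have hy2 := hy.2
    have d := ((Real.hasDerivAt_rpow_const (x := w - y) (p := β) (Or.inl (by linarith))).comp_sub_const w y).mul_const (u y)
    exact d

lemma far_bound (α : ℝ) (h1 : 1 < α) (h2 : α < 2) (u : ℝ → ℝ) (hu : Measurable u) (M : ℝ)
    (hM : ∀ y, |u y| ≤ M) (a b z : ℝ) (ha : 0 ≤ a) (hab : a ≤ b) (hz : b < z)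
    (hs : ∀ y, y < a ∨ b ≤ y → u y = 0) :
    |deriv (deriv (fun z => ∫ y in (0:ℝ)..z, (z - y) ^ (1 - α) * u y)) z|
      ≤ 2 * M * (z-b)^(-1-α) * (b-a) := by
  have M0 : 0 ≤ M := (abs_nonneg _).trans (hM 0)
  have hint : ∀ w c d, IntervalIntegrable (fun y => (w-y)^(1-α) * u y) volume c d := by
    intro w c d
    refine ((ker_int (1-α) (by linarith) c d w).mul_const M).mono_fun ?_ ?_
    · have : Measurable fun y => (w-y)^(1-α) * u y := by fun_prop
      exact this.aestronglyMeasurable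
    · filter_upwards with y
      rw [norm_mul, norm_mul, Real.norm_eq_abs (u y), Real.norm_eq_abs M, abs_of_nonneg M0]
      have := hM y
      gcongr
  have hF : ∀ w, b < w → (∫ y in (0:ℝ)..w, (w - y) ^ (1 - α) * u y) =
      ∫ y in a..b, (w - y) ^ (1 - α) * u y := by
    intro w hw
    rw [← intervalIntegral.integral_add_adjacent_intervals (hint w 0 a) (hint w a w),
      ← intervalIntegral.integral_add_adjacent_intervals (hint w a b) (hint w b w)]
    rw [intervalIntegral.integral_congr_Ioo_of_le (a := 0) (b := a) (g := fun _ => 0) ha,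
      intervalIntegral.integral_congr_Ioo_of_le (a := b) (b := w) (g := fun _ => 0) hw.le]
    · simp
    · intro y hy; beta_reduce; rw [hs y (Or.inr hy.1.le), mul_zero]
    · intro y hy; beta_reduce; rw [hs y (Or.inl hy.2), mul_zero]
  have d1 : ∀ w, b < w → deriv (fun z => ∫ y in (0:ℝ)..z, (z - y) ^ (1 - α) * u y) w =
      (1-α) * ∫ y in a..b, (w-y)^(-α) * u y := by
    intro w hw
    have := far_deriv (1-α) (by linarith) u hu M hM a b w hab hw
    rw [Filter.EventuallyEq.deriv_eq (f := fun w => ∫ y in a..b, (w-y)^(1-α) * u y), this.deriv,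
      ← intervalIntegral.integral_const_mul]
    · refine intervalIntegral.integral_congr fun y _ => ?_
      beta_reduce
      rw [show 1-α-1 = -α by ring]; ring
    · filter_upwards [Ioi_mem_nhds hw] with v hv
      exact hF v hv
  have d2 := (far_deriv (-α) (by linarith) u hu M hM a b z hab hz).const_mul (1-α)
  rw [Filter.EventuallyEq.deriv_eq (f := fun w => (1-α) * ∫ y in a..b, (w-y)^(-α) * u y), d2.deriv]
  · have hb := intervalIntegral.norm_integral_le_of_norm_le_const (a := a) (b := b)
      (f := fun y => -α * (z-y)^(-α-1) * u y) (C := α * (z-b)^(-1-α) * M) (by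
        intro y hy
        rw [uIoc_of_le hab] at hy
        have hy2 := hy.2
        have : (z-y)^(-α-1) ≤ (z-b)^(-α-1) :=
          Real.rpow_le_rpow_of_nonpos (by linarith) (by linarith) (by linarith)
        have h0 : 0 ≤ (z-y)^(-α-1) := Real.rpow_nonneg (by linarith) _
        rw [Real.norm_eq_abs, abs_mul, abs_mul, abs_of_nonneg h0, abs_neg, abs_of_nonneg (by linarith),
          show -1-α = -α-1 by ring]
        have := hM y
        gcongr)
    rw [Real.norm_eq_abs, abs_of_nonneg (show 0 ≤ b - a by linarith)] at hb
    rw [abs_mul, abs_of_nonpos (show 1-α ≤ 0 by linarith)]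
    have hpos : 0 ≤ M * (z-b)^(-1-α) * (b-a) :=
      mul_nonneg (mul_nonneg M0 (Real.rpow_nonneg (by linarith) _)) (by linarith)
    calc _ ≤ -(1-α) * (α * (z-b)^(-1-α) * M * (b-a)) := by
          refine mul_le_mul_of_nonneg_left hb (by linarith)
      _ = ((α-1)*α) * (M * (z-b)^(-1-α) * (b-a)) := by ring
      _ ≤ 2 * (M * (z-b)^(-1-α) * (b-a)) := by
        refine mul_le_mul_of_nonneg_right ?_ hpos
        nlinarith
      _ = _ := by ring
  · filter_upwards [Ioi_mem_nhds hz] with v hv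
    exact d1 v hv

lemma grev_lower (p n i : ℕ) (hp : 2 ≤ p) (hn : 1 ≤ n) (hi : 2 ≤ i) :
    1/((n:ℝ)*p) ≤ greville p n i := by
  have hn' : (0:ℝ) < n := by positivity
  have hp' : (0:ℝ) < p := by positivity
  unfold greville
  rw [← div_div]
  gcongr
  have h : 1/(n:ℝ) ≤ knot p n (i+1+(p-1)) := by
    rw [knot_eq p n _ hn]
    gcongr
    have : 1 ≤ min n (i+1+(p-1) - (p+1)) := by omega
    exact_mod_cast this
  exact h.trans (Finset.single_le_sum (f := fun j => knot p n (i+1+j))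
    (fun j _ => knot_nonneg p n _ hn) (Finset.mem_range.2 (by omega)))

lemma grev_upper (p n i : ℕ) (hp : 2 ≤ p) (hn : 1 ≤ n) (hi : i ≤ n+p-1) :
    greville p n i < 1 := by
  have hn' : (0:ℝ) < n := by positivity
  have hp' : (0:ℝ) < p := by positivity
  unfold greville
  rw [div_lt_one hp']
  have : ∑ j ∈ Finset.range p, knot p n (i+1+j) < ∑ j ∈ Finset.range p, (1:ℝ) := by
    refine Finset.sum_lt_sum (fun j _ => knot_le_one p n _ hn) ⟨0, Finset.mem_range.2 (by omega), ?_⟩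
    rw [knot_eq p n _ hn, div_lt_one hn']
    have : min n (i+1+0 - (p+1)) < n := by omega
    exact_mod_cast this
  simpa using this
theorem stmt13 (p : ℕ) (hp : 2 ≤ p) (α : ℝ) (h1 : 1 < α) (h2 : α < 2) :
    ∃ c > (0 : ℝ), ∀ n : ℕ, 1 ≤ n → ∀ i j : ℕ,
      2 ≤ i → i ≤ n + p - 1 → 2 ≤ j → j ≤ n + p - 1 →
      ((greville p n i ≤ knot p n j →
          RLD0x α (bspline p n p j) (greville p n i) = 0) ∧
        (knot p n j < greville p n i → greville p n i ≤ knot p n (j + p + 1) + 1 / (n : ℝ) →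
          |RLD0x α (bspline p n p j) (greville p n i)| ≤ c * (n : ℝ) ^ α) ∧
        (knot p n (j + p + 1) + 1 / (n : ℝ) < greville p n i →
          |RLD0x α (bspline p n p j) (greville p n i)|
            ≤ c * (greville p n i - knot p n (j + p + 1)) ^ (-α))) := by
  obtain ⟨C, hC⟩ := bs_rep1 p (by omega)
  have hC0 : 0 ≤ C := (hC 1 le_rfl 2 le_rfl).nonneg
  have hK := Kc_nonneg p α
  set g := |1 / Real.Gamma (2 - α)| with hg
  have hg0 : 0 ≤ g := abs_nonneg _
  refine ⟨g * (C * Kc p α + 2 * 2^p * (p+1)) + 1, by positivity, ?_⟩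
  intro n hn i j hi hi2 hj hj2
  have hn' : (0:ℝ) < n := by positivity
  have hl := grev_lower p n i hp hn hi
  have hu := grev_upper p n i hp hn hi2
  set z := greville p n i with hzdef
  have hz : z ∈ Set.Ioo (0:ℝ) 1 := ⟨lt_of_lt_of_le (by positivity) hl, hu⟩
  have hw : knot p n (j+p+1) ≤ knot p n j + ((p:ℝ)+1)/n := by
    have := knot_width p n j (p+1) hn
    push_cast at this
    exact this
  obtain ⟨-, G, H, P⟩ := rep_main p hp α h1 h2 n hn _ _ C hw _ (hC n hn j hj)
  have hder : deriv (deriv (fun z => ∫ y in (0:ℝ)..z, (z - y) ^ (1 - α) * bspline p n p j y)) z = H z := by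
    rw [Filter.EventuallyEq.deriv_eq (f := G), (P z hz).2.1.deriv]
    filter_upwards [Ioo_mem_nhds hz.1 hz.2] with w hw
    exact (P w hw).1.deriv
  obtain ⟨-, -, Q1, Q2⟩ := P z hz
  refine ⟨?_, ?_, ?_⟩
  · intro h
    rw [RLD0x, hder, Q1 h, mul_zero]
  · intro _ h
    rw [RLD0x, hder, abs_mul, ← hg]
    have hna : 0 ≤ (n:ℝ)^α := by positivity
    have q := mul_le_mul_of_nonneg_left (Q2 hl h) hg0
    have e : 0 ≤ (g * (2 * 2^p * (p+1)) + 1) * (n:ℝ)^α := by positivity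
    linarith
  · intro h
    rw [RLD0x, abs_mul, ← hg]
    have hin : 0 < 1/(n:ℝ) := by positivity
    have hab := knot_mono p n hn (show j ≤ j+p+1 by omega)
    have q := far_bound α h1 h2 (bspline p n p j) (bs_meas p n p j) (2^p) (bs_bound p n hn p j)
      (knot p n j) (knot p n (j+p+1)) z (knot_nonneg p n j hn) hab (by linarith)
      (bs_supp p n hn p j)
    set d := z - knot p n (j+p+1) with hd
    have hd0 : 1/(n:ℝ) < d := by rw [hd]; linarith
    have hdp : 0 < d := by linarith
    have hda : 0 ≤ d^(-α) := by positivity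
    have q2 : d^(-1-α) * (knot p n (j+p+1) - knot p n j) ≤ (p+1) * d^(-α) := by
      have e : d^(-1-α) = d^(-α) * d⁻¹ := by
        rw [show -1-α = -α + -1 by ring, Real.rpow_add hdp, Real.rpow_neg_one]
      have e2 : knot p n (j+p+1) - knot p n j ≤ (p+1) * d := by
        calc _ ≤ ((p:ℝ)+1) * (1/n) := by rw [mul_one_div]; linarith
          _ ≤ _ := by gcongr
      rw [e]
      calc _ ≤ d^(-α) * d⁻¹ * ((p+1)*d) := by gcongr
        _ = _ := by field_simp
    have q3 := mul_le_mul_of_nonneg_left (q.trans (show _ ≤ (2 * 2^p * (p+1)) * d^(-α) by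
      have := mul_le_mul_of_nonneg_left q2 (show (0:ℝ) ≤ 2 * 2^p by positivity)
      linarith)) hg0
    have e : 0 ≤ (g * (C * Kc p α) + 1) * d^(-α) := by positivity
    linarith
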